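/- For all integers a ∈ ℤ, b ≥ 0 and every g ∈ Λ_F: η_a(v⁽⁰⁾_b · g) = Σ_{k=0}^{b} (−1)^k v⁽⁰⁾_{b−k} · (η_{a−k} g). -/

import Mathlib

noncomputable section
open scoped BigOperators
set_option maxHeartbeats 1000000
set_option synthInstance.maxHeartbeats 400000

/-- The field `F = ℚ(q,t)` of rational functions in two indeterminates. -/
abbrev F : Type := FractionRing (MvPolynomial (Fin 2) ℚ)

/-- The indeterminate `q`. -/
def q : F := algebraMap (MvPolynomial (Fin 2) ℚ) F (MvPolynomial.X 0)

/-- The indeterminate `t`. -/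
def t : F := algebraMap (MvPolynomial (Fin 2) ℚ) F (MvPolynomial.X 1)

/-- The ring `Λ_F = F[p₁, p₂, …]` of symmetric functions (polynomials in the power sums). -/
abbrev SF : Type := MvPolynomial ℕ+ F

/-- The power sum `p_n` (junk value `1` for `n = 0`). -/
def pvar (n : ℕ) : SF := if h : 0 < n then MvPolynomial.X ⟨n, h⟩ else 1

/-- Multiplication by `p_n` as a linear operator. -/
def mulP (n : ℕ) : Module.End F SF := LinearMap.mulLeft F (pvar n)

/-- The derivation `∂/∂p_n` as a linear operator (junk value `0` for `n = 0`). -/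
def pd (n : ℕ) : Module.End F SF :=
  if h : 0 < n then (MvPolynomial.pderiv (⟨n, h⟩ : ℕ+)).toLinearMap else 0

/-- The coefficient of `z^d` in `exp (∑_{n>0} A n z^n)`, where the `A n` are pairwise
commuting operators: it equals `∑_k (1/k!) ∑_{n₁+⋯+n_k = d, nᵢ ≥ 1} A n₁ ⋯ A n_k`,
a sum over compositions of `d`. -/
def expCoeff (A : ℕ → Module.End F SF) (d : ℕ) : Module.End F SF :=
  ∑ c : Composition d, ((c.length.factorial : F)⁻¹) • (c.blocks.map A).prod

/-- `D_d`, the coefficient of `z^{-d}` in `D(z) = exp (∑_{n>0} (1-q^n) ∂_{p_n} z^{-n})`. -/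
def Dop (d : ℕ) : Module.End F SF := expCoeff (fun n => (1 - q ^ n) • pd n) d

/-- The coefficient of `z^a` in `exp (∑_{n>0} ((1-t^{-n})/n) p_n z^n)`. -/
def Pplus (a : ℕ) : Module.End F SF :=
  expCoeff (fun n => ((1 - t⁻¹ ^ n) / (n : F)) • mulP n) a

/-- The coefficient of `z^{-b}` in `exp (-∑_{n>0} (1-q^n) ∂_{p_n} z^{-n})`. -/
def Nminus (b : ℕ) : Module.End F SF :=
  expCoeff (fun n => (-(1 - q ^ n)) • pd n) b

/-- The weighted total degree of `f`, with `p_n` of degree `n`. -/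
def wdeg (f : SF) : ℕ := MvPolynomial.weightedTotalDegree (fun n : ℕ+ => (n : ℕ)) f

/-- `η_d f`: the coefficient of `z^{-d}` in `η(z) f`, where
`η(z) = exp (∑_{n>0} ((1-t^{-n})/n) p_n z^n) ⬝ exp (-∑_{n>0} (1-q^n) ∂_{p_n} z^{-n})`.
Only the terms with `b ≤ wdeg f` contribute, since the degree-lowering part kills `f`
beyond that range. -/
def eta (d : ℤ) (f : SF) : SF :=
  ∑ b ∈ Finset.range (wdeg f + 1),
    if d ≤ (b : ℤ) then Pplus ((b : ℤ) - d).toNat (Nminus b f) else 0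

/-- The coefficient of `w^n` in `exp (∑_{m>0} a m w^m)` for commuting elements `a m`. -/
def expGF (a : ℕ → SF) (n : ℕ) : SF :=
  ∑ c : Composition n, ((c.length.factorial : F)⁻¹) • (c.blocks.map a).prod

/-- `v⁽⁰⁾_n`, defined by `∑_{n≥0} (-w)^n v⁽⁰⁾_n = exp (-∑_{m>0} p_m w^m/(m(1-q^m)))`. -/
def v0 (n : ℕ) : SF :=
  (-1 : SF) ^ n * expGF (fun m => -(((m : F) * (1 - q ^ m))⁻¹ • pvar m)) n

/-- `v^{(∞)}_n`, defined by `∑_{n≥0} w^n v^{(∞)}_n = exp (∑_{m>0} p_m w^m/(m(1-q^m)))`. -/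
def vInf (n : ℕ) : SF :=
  expGF (fun m => ((m : F) * (1 - q ^ m))⁻¹ • pvar m) n

section EulerSeries

variable {R : Type*} [Ring R]

/-- The power series `∑_{i>0} A i X^i`. -/
def posSeries (A : ℕ → R) : PowerSeries R :=
  PowerSeries.mk fun i => if i = 0 then 0 else A i

/-- The power series `∑_{i>0} i A i X^i`. -/
def eulerSeries (A : ℕ → R) : PowerSeries R :=
  PowerSeries.mk fun i => (i : R) * A i

lemma commute_eulerSeries {A : ℕ → R} (hA : ∀ i j, Commute (A i) (A j)) :
    posSeries A * eulerSeries A = eulerSeries A * posSeries A := by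
  ext n
  rw [PowerSeries.coeff_mul, PowerSeries.coeff_mul, ← Finset.Nat.sum_antidiagonal_swap]
  refine Finset.sum_congr rfl fun x _ => ?_
  simp only [posSeries, eulerSeries, PowerSeries.coeff_mk, Prod.fst_swap, Prod.snd_swap]
  split_ifs
  · simp
  · rw [← mul_assoc, ← (Nat.cast_commute x.1 (A x.2)).eq, mul_assoc, mul_assoc, (hA _ _).eq]

end EulerSeries

section CompositionSums

variable {R : Type*} [Ring R] [Algebra F R]

/-- The sum over compositions of `n` of the products of the `A i` over the blocks, weighted by
a function `w` of the number of blocks. -/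
def compSum (A : ℕ → R) (w : ℕ → F) (n : ℕ) : R :=
  ∑ c : Composition n, w c.length • (c.blocks.map A).prod

lemma compSum_zero (A : ℕ → R) (w : ℕ → F) : compSum A w 0 = w 0 • (1 : R) := by
  have h : ∀ c : Composition 0, c.blocks = [] := fun c => by
    rw [← List.length_eq_zero_iff]
    simp
  rw [compSum, Fintype.sum_eq_single (default : Composition 0) fun c hc =>
    absurd (Composition.ext ((h c).trans (h default).symm)) hc]
  simp [h, Composition.length]

/-- Splitting off the first block of a composition. -/
lemma compSum_succ (A : ℕ → R) (w : ℕ → F) (n : ℕ) :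
    compSum A w (n + 1) =
      ∑ x ∈ Finset.HasAntidiagonal.antidiagonal n,
        A (x.1 + 1) * compSum A (fun l => w (l + 1)) x.2 := by
  simp only [compSum, Finset.mul_sum]
  rw [Finset.sum_sigma']
  symm
  refine Finset.sum_bij
    (fun (x : (x : ℕ × ℕ) × Composition x.2) (hx : x ∈ _) =>
      (⟨(x.1.1 + 1) :: x.2.blocks, ?_, ?_⟩ : Composition (n + 1))) ?_ ?_ ?_ ?_
  · intro i hi
    rcases List.mem_cons.1 hi with rfl | hi
    · exact Nat.succ_pos _
    · exact x.2.blocks_pos hi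
  · have h := Finset.HasAntidiagonal.mem_antidiagonal.1 (Finset.mem_sigma.1 hx).1
    rw [List.sum_cons, x.2.blocks_sum]
    lia
  · intros
    exact Finset.mem_univ _
  · rintro ⟨⟨i, j⟩, c⟩ hx ⟨⟨i', j'⟩, c'⟩ hx' h
    simp only [Composition.mk.injEq, List.cons.injEq, Nat.add_right_cancel_iff] at h
    obtain ⟨rfl, h⟩ := h
    have hj : j = j' := by
      have h₁ := c.blocks_sum
      have h₂ := c'.blocks_sum
      rw [h] at h₁
      exact h₁.symm.trans h₂
    subst hj
    rw [Composition.ext h]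
  · rintro ⟨l, hpos, hsum⟩ -
    cases l with
    | nil => simp at hsum
    | cons i l =>
      have hi : 0 < i := hpos (by simp)
      rw [List.sum_cons] at hsum
      refine ⟨⟨(i - 1, l.sum), ⟨l, fun h => hpos (List.mem_cons_of_mem _ h), rfl⟩⟩, ?_, ?_⟩
      · simp only [Finset.mem_sigma, Finset.HasAntidiagonal.mem_antidiagonal,
          Finset.mem_univ, and_true]
        lia
      · simp only [Composition.mk.injEq, List.cons.injEq, and_true]
        lia
  · rintro ⟨⟨i, j⟩, c⟩ hx
    simp [Composition.length]

lemma compSum_add (A : ℕ → R) (w w' : ℕ → F) (n : ℕ) :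
    compSum A (fun l => w l + w' l) n = compSum A w n + compSum A w' n := by
  simp only [compSum, add_smul, Finset.sum_add_distrib]

lemma commute_compSum {A : ℕ → R} {x : R} (h : ∀ i, Commute x (A i)) (w : ℕ → F) (n : ℕ) :
    Commute x (compSum A w n) :=
  Commute.sum_right _ _ _ fun c _ => (Commute.list_prod_right _ _ fun y hy => by
    obtain ⟨i, -, rfl⟩ := List.mem_map.1 hy
    exact h i).smul_right _

lemma coeff_posSeries_mul (A : ℕ → R) (w : ℕ → F) (n : ℕ) :
    PowerSeries.coeff n (posSeries A * PowerSeries.mk (compSum A fun l => w (l + 1))) =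
      if n = 0 then 0 else compSum A w n := by
  cases n with
  | zero => simp [posSeries, PowerSeries.coeff_mul]
  | succ n =>
    rw [PowerSeries.coeff_mul, Finset.Nat.sum_antidiagonal_succ, compSum_succ]
    simp [posSeries]

lemma natCast_mul_compSum {A : ℕ → R} (hA : ∀ i j, Commute (A i) (A j)) (n : ℕ) :
    ∀ w : ℕ → F, (n : R) * compSum A w n =
      PowerSeries.coeff n
        (eulerSeries A * PowerSeries.mk (compSum A fun l => (l + 1 : F) * w (l + 1))) := by
  induction n using Nat.strong_induction_on with
  | _ n ih =>
  intro w
  rcases Nat.eq_zero_or_pos n with rfl | hn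
  · simp [eulerSeries, PowerSeries.coeff_mul]
  have h₁ : compSum A w n = ∑ x ∈ Finset.HasAntidiagonal.antidiagonal n,
      PowerSeries.coeff x.1 (posSeries A) * compSum A (fun l => w (l + 1)) x.2 := by
    have h := coeff_posSeries_mul A w n
    rw [if_neg hn.ne', PowerSeries.coeff_mul] at h
    simpa using h.symm
  have h₂ : (n : R) * compSum A w n =
      PowerSeries.coeff n (eulerSeries A * PowerSeries.mk (compSum A fun l => w (l + 1))) +
      PowerSeries.coeff n (posSeries A * (eulerSeries A *
        PowerSeries.mk (compSum A fun l => (l + 1 : F) * w (l + 1 + 1)))) := by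
    rw [h₁, PowerSeries.coeff_mul, PowerSeries.coeff_mul, Finset.mul_sum,
      ← Finset.sum_add_distrib]
    refine Finset.sum_congr rfl fun x hx => ?_
    have hxn := Finset.HasAntidiagonal.mem_antidiagonal.1 hx
    by_cases h0 : x.1 = 0
    · simp [posSeries, eulerSeries, h0]
    · have hi : (x.2 : R) * compSum A (fun l => w (l + 1)) x.2 =
          PowerSeries.coeff x.2 (eulerSeries A *
            PowerSeries.mk (compSum A fun l => (l + 1 : F) * w (l + 1 + 1))) :=
        ih x.2 (by lia) _
      rw [← hi]
      simp only [posSeries, eulerSeries, PowerSeries.coeff_mk, if_neg h0]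
      rw [← hxn, Nat.cast_add, add_mul, ← mul_assoc, ← mul_assoc, ← mul_assoc,
        (Nat.cast_commute x.2 (A x.1)).eq]
  have h₃ : posSeries A * PowerSeries.mk (compSum A fun l => (l + 1 : F) * w (l + 1 + 1)) =
      PowerSeries.mk (compSum A fun l => (l : F) * w (l + 1)) := by
    ext m
    have h := coeff_posSeries_mul A (fun l => (l : F) * w (l + 1)) m
    simp only [Nat.cast_add, Nat.cast_one] at h
    rw [h, PowerSeries.coeff_mk]
    split_ifs with hm
    · simp [hm, compSum_zero]
    · rfl
  rw [h₂, ← mul_assoc, commute_eulerSeries hA, mul_assoc, h₃, ← map_add, ← mul_add]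
  congr 2
  ext m
  simp only [map_add, PowerSeries.coeff_mk, ← compSum_add]
  congr 1
  ext l
  ring

/-- The recursion `n E_n = ∑_{i+j=n} i A_i E_j` for the coefficients `E_n` of
`exp (∑_{i>0} A_i z^i)`, where the `A_i` commute. -/
lemma succ_mul_compSum {A : ℕ → R} (hA : ∀ i j, Commute (A i) (A j)) (n : ℕ) :
    ((n + 1 : ℕ) : R) * compSum A (fun l => (l.factorial : F)⁻¹) (n + 1) =
      ∑ x ∈ Finset.HasAntidiagonal.antidiagonal n, ((x.1 + 1 : ℕ) : R) *
        (A (x.1 + 1) * compSum A (fun l => (l.factorial : F)⁻¹) x.2) := by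
  have hw : (fun l : ℕ => (l + 1 : F) * ((l + 1).factorial : F)⁻¹) =
      fun l => (l.factorial : F)⁻¹ := by
    ext l
    have : (l + 1 : F) ≠ 0 := by exact_mod_cast l.succ_ne_zero
    rw [Nat.factorial_succ, Nat.cast_mul, mul_inv, ← mul_assoc, Nat.cast_succ,
      mul_inv_cancel₀ this, one_mul]
  rw [natCast_mul_compSum hA, hw, PowerSeries.coeff_mul, Finset.Nat.sum_antidiagonal_succ]
  simp [eulerSeries, mul_assoc]

end CompositionSums

lemma expCoeff_eq_compSum (A : ℕ → Module.End F SF) (n : ℕ) :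
    expCoeff A n = compSum A (fun l => (l.factorial : F)⁻¹) n := rfl

lemma expGF_eq_compSum (a : ℕ → SF) (n : ℕ) :
    expGF a n = compSum a (fun l => (l.factorial : F)⁻¹) n := rfl

lemma pd_zero : pd 0 = 0 := dif_neg (lt_irrefl 0)

lemma pd_succ (i : ℕ) : pd (i + 1) = (MvPolynomial.pderiv i.succPNat).toLinearMap :=
  dif_pos i.succ_pos

lemma pd_succ_apply (i : ℕ) (f : SF) : pd (i + 1) f = MvPolynomial.pderiv i.succPNat f := by
  rw [pd_succ]
  rfl

lemma pvar_succ (i : ℕ) : pvar (i + 1) = MvPolynomial.X i.succPNat :=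
  dif_pos i.succ_pos

lemma pd_mul (n : ℕ) (f g : SF) : pd n (f * g) = f * pd n g + pd n f * g := by
  cases n with
  | zero => simp [pd_zero]
  | succ i =>
    simp only [pd_succ_apply, MvPolynomial.pderiv_mul]
    ring

lemma pd_one (n : ℕ) : pd n 1 = 0 := by
  cases n with
  | zero => simp [pd_zero]
  | succ i => rw [pd_succ_apply, MvPolynomial.pderiv_one]

lemma pd_succ_pvar_succ (i j : ℕ) : pd (i + 1) (pvar (j + 1)) = if i = j then 1 else 0 := by
  rw [pd_succ_apply, pvar_succ]
  split_ifs with h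
  · subst h
    exact MvPolynomial.pderiv_X_self _
  · exact MvPolynomial.pderiv_X_of_ne fun h' => h (Nat.succPNat_injective h').symm

lemma commute_pd (m n : ℕ) : Commute (pd m) (pd n) := by
  cases m with
  | zero => simp [pd_zero]
  | succ m =>
  cases n with
  | zero => simp [pd_zero]
  | succ n =>
  refine LinearMap.ext fun f => ?_
  simp only [Module.End.mul_apply, pd_succ_apply]
  ext s
  simp only [MvPolynomial.coeff_pderiv, add_right_comm s, Finsupp.add_apply]
  by_cases h : m = n
  · subst h; rfl
  · have h₁ : m.succPNat ≠ n.succPNat := fun h' => h (Nat.succPNat_injective h')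
    rw [Finsupp.single_eq_of_ne h₁, Finsupp.single_eq_of_ne h₁.symm]
    push_cast
    ring

lemma commute_mulP (f : SF) (n : ℕ) : Commute (LinearMap.mulLeft F f) (mulP n) := by
  refine LinearMap.ext fun g => ?_
  simp only [mulP, Module.End.mul_apply, LinearMap.mulLeft_apply]
  ring

lemma Pplus_mul (n : ℕ) (f g : SF) : Pplus n (f * g) = f * Pplus n g := by
  have h : Commute (LinearMap.mulLeft F f) (Pplus n) :=
by
    rw [Pplus, expCoeff_eq_compSum]
    exact commute_compSum (fun i => (commute_mulP f i).smul_right _) _ n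
  exact (LinearMap.congr_fun h.eq g).symm

lemma commute_smul_pd (m n : ℕ) :
    Commute (-(1 - q ^ m) • pd m) (-(1 - q ^ n) • pd n) :=
  ((commute_pd m n).smul_left _).smul_right _

lemma Nminus_eq_compSum (n : ℕ) :
    Nminus n = compSum (fun m => -(1 - q ^ m) • pd m) (fun l => (l.factorial : F)⁻¹) n :=
  expCoeff_eq_compSum _ n

lemma Nminus_pd (m n : ℕ) (f : SF) :
    -(1 - q ^ m) • pd m (Nminus n f) = Nminus n (-(1 - q ^ m) • pd m f) := by
  have h : Commute (-(1 - q ^ m) • pd m) (Nminus n) := by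
    rw [Nminus_eq_compSum]
    exact commute_compSum (fun i => commute_smul_pd m i) _ n
  exact LinearMap.congr_fun h.eq f

/-- The recursion for the coefficients of the degree-lowering vertex operator. -/
lemma succ_mul_Nminus (n : ℕ) (f : SF) :
    ((n + 1 : ℕ) : SF) * Nminus (n + 1) f =
      ∑ x ∈ Finset.HasAntidiagonal.antidiagonal n,
        ((x.1 + 1 : ℕ) : SF) * Nminus x.2 (-(1 - q ^ (x.1 + 1)) • pd (x.1 + 1) f) := by
  have h := succ_mul_compSum (R := Module.End F SF) commute_smul_pd n
  simp only [← Nminus_eq_compSum] at h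
  have h' := LinearMap.congr_fun h f
  simp only [LinearMap.sum_apply, Module.End.mul_apply, Module.End.natCast_apply,
    LinearMap.smul_apply] at h'
  simp only [← Nminus_pd, ← nsmul_eq_mul]
  exact h'

lemma Nminus_zero (f : SF) : Nminus 0 f = f := by
  rw [Nminus_eq_compSum, compSum_zero, Nat.factorial_zero, Nat.cast_one, inv_one, one_smul]
  rfl

lemma Nminus_eq_zero (n : ℕ) : ∀ f : SF,
    (∀ s, n ≤ Finsupp.weight (fun i : ℕ+ => (i : ℕ)) s → f.coeff s = 0) → Nminus n f = 0 := by
  induction n using Nat.strong_induction_on with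
  | _ n ih =>
  intro f hf
  cases n with
  | zero =>
    have : f = 0 := MvPolynomial.ext _ _ fun s => by simpa using hf s (Nat.zero_le _)
    rw [this, map_zero]
  | succ n =>
    have hn : ((n + 1 : ℕ) : SF) ≠ 0 := Nat.cast_ne_zero.2 n.succ_ne_zero
    refine (mul_eq_zero.1 ?_).resolve_left hn
    rw [succ_mul_Nminus]
    refine Finset.sum_eq_zero fun x hx => ?_
    have hxn := Finset.HasAntidiagonal.mem_antidiagonal.1 hx
    rw [ih x.2 (by lia), mul_zero]
    intro s hs
    rw [MvPolynomial.coeff_smul, pd_succ_apply, MvPolynomial.coeff_pderiv, hf, zero_mul, smul_zero]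
    rw [map_add, Finsupp.weight_single]
    simp only [Nat.succPNat_coe, smul_eq_mul, one_mul]
    lia

lemma eta_eq_sum (d : ℤ) (f : SF) {M : ℕ} (hM : wdeg f + 1 ≤ M) :
    eta d f = ∑ b ∈ Finset.range M,
      if d ≤ (b : ℤ) then Pplus ((b : ℤ) - d).toNat (Nminus b f) else 0 := by
  refine Finset.sum_subset (Finset.range_subset_range.2 hM) fun b _ hb => ?_
  rw [Nminus_eq_zero b f, map_zero, ite_self]
  intro s hs
  by_contra h
  have h' : Finsupp.weight (fun i : ℕ+ => (i : ℕ)) s ≤ wdeg f :=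
    MvPolynomial.le_weightedTotalDegree _ (MvPolynomial.mem_support_iff.2 h)
  rw [Finset.mem_range] at hb
  lia

lemma eta_neg (d : ℤ) (f : SF) : eta d (-f) = -eta d f := by
  rw [eta_eq_sum d f (le_max_left _ (wdeg (-f) + 1)),
    eta_eq_sum d (-f) (le_max_right (wdeg f + 1) _), ← Finset.sum_neg_distrib]
  refine Finset.sum_congr rfl fun b _ => ?_
  split_ifs <;> simp

/-- The coefficient of `w^n` in `exp (-∑_{m>0} p_m w^m/(m(1-q^m)))`. -/
def expV (n : ℕ) : SF :=
  expGF (fun m => -(((m : F) * (1 - q ^ m))⁻¹ • pvar m)) n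

lemma expV_zero : expV 0 = 1 := by
  rw [expV, expGF_eq_compSum, compSum_zero, Nat.factorial_zero, Nat.cast_one, inv_one, one_smul]

lemma one_sub_q_pow_succ_ne_zero (n : ℕ) : 1 - q ^ (n + 1) ≠ 0 := by
  have h : algebraMap (MvPolynomial (Fin 2) ℚ) F (1 - MvPolynomial.X 0 ^ (n + 1)) =
      1 - q ^ (n + 1) := by
    rw [q, map_sub, map_pow, map_one]
  rw [← h]
  intro h₀
  have h₁ := (IsFractionRing.to_map_eq_zero_iff (R := MvPolynomial (Fin 2) ℚ) (K := F)).1 h₀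
  simpa using congrArg MvPolynomial.constantCoeff h₁

/-- The coefficient of `w^c` in `w^i exp (-∑_{m>0} p_m w^m/(m(1-q^m)))`. -/
def shiftV (c i : ℕ) : SF := if i ≤ c then expV (c - i) else 0

lemma shiftV_zero_right (c : ℕ) : shiftV c 0 = expV c := by simp [shiftV]

lemma shiftV_zero_succ (i : ℕ) : shiftV 0 (i + 1) = 0 := by simp [shiftV]

lemma shiftV_succ_succ (c i : ℕ) : shiftV (c + 1) (i + 1) = shiftV c i := by simp [shiftV]

/-- The coefficient `-1/(m(1-q^m))` of `p_m w^m`. -/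
def expVScalar (m : ℕ) : F := -((m : F) * (1 - q ^ m))⁻¹

lemma succ_mul_expV (n : ℕ) :
    ((n + 1 : ℕ) : SF) * expV (n + 1) = ∑ x ∈ Finset.HasAntidiagonal.antidiagonal n,
      ((x.1 + 1 : ℕ) : SF) * (expVScalar (x.1 + 1) • pvar (x.1 + 1) * expV x.2) := by
  have h := succ_mul_compSum (R := SF)
    (A := fun m => -(((m : F) * (1 - q ^ m))⁻¹ • pvar m)) (fun _ _ => Commute.all _ _) n
  simp only [← expGF_eq_compSum] at h
  simp only [expVScalar, neg_smul]
  exact h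

lemma sum_mul_shiftV (m : ℕ) : ∀ c : ℕ,
    ∑ x ∈ Finset.HasAntidiagonal.antidiagonal c, ((x.1 + 1 : ℕ) : SF) *
      (expVScalar (x.1 + 1) • pvar (x.1 + 1) * shiftV x.2 m) =
      ((c + 1 : SF) - m) * shiftV (c + 1) m := by
  induction m with
  | zero =>
    intro c
    simp only [shiftV_zero_right, ← succ_mul_expV]
    simp
  | succ m ih =>
    intro c
    rw [shiftV_succ_succ]
    cases c with
    | zero => cases m <;> simp [shiftV_zero_succ]
    | succ c =>
      rw [Finset.Nat.sum_antidiagonal_succ']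
      simp only [shiftV_zero_succ, shiftV_succ_succ, mul_zero, zero_add]
      rw [ih c]
      push_cast
      ring

lemma pd_expV (m c : ℕ) :
    pd (m + 1) (expV c) = expVScalar (m + 1) • shiftV c (m + 1) := by
  induction c using Nat.strong_induction_on with
  | _ c ih =>
  cases c with
  | zero => rw [expV_zero, pd_one, shiftV_zero_succ, smul_zero]
  | succ c =>
    have hc : ((c + 1 : ℕ) : SF) ≠ 0 := Nat.cast_ne_zero.2 c.succ_ne_zero
    refine mul_left_cancel₀ hc ?_
    have hcast : ∀ (n : ℕ) (f : SF), (n : SF) * pd (m + 1) f = pd (m + 1) ((n : SF) * f) :=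
      fun n f => by rw [← nsmul_eq_mul, ← nsmul_eq_mul, map_nsmul]
    have hsum : ∑ x ∈ Finset.HasAntidiagonal.antidiagonal c, ((x.1 + 1 : ℕ) : SF) *
        ((expVScalar (x.1 + 1) • if m = x.1 then (1 : SF) else 0) * expV x.2) =
        ((m + 1 : ℕ) : SF) * (expVScalar (m + 1) • shiftV c m) := by
      rw [Finset.Nat.sum_antidiagonal_eq_sum_range_succ_mk]
      simp only [smul_ite, smul_zero, ite_mul, zero_mul, mul_ite, mul_zero, Finset.sum_ite_eq,
        Finset.mem_range, Nat.lt_succ_iff, shiftV]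
      split_ifs
      · rw [smul_one_mul]
      · rfl
    have hterm : ∀ x ∈ Finset.HasAntidiagonal.antidiagonal c,
        pd (m + 1) (((x.1 + 1 : ℕ) : SF) * (expVScalar (x.1 + 1) • pvar (x.1 + 1) * expV x.2)) =
        expVScalar (m + 1) • (((x.1 + 1 : ℕ) : SF) *
          (expVScalar (x.1 + 1) • pvar (x.1 + 1) * shiftV x.2 (m + 1))) +
        ((x.1 + 1 : ℕ) : SF) *
          ((expVScalar (x.1 + 1) • if m = x.1 then (1 : SF) else 0) * expV x.2) := by
      intro x hx
      have hxc := Finset.HasAntidiagonal.mem_antidiagonal.1 hx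
      rw [← hcast, pd_mul, map_smul, pd_succ_pvar_succ, ih x.2 (by lia), mul_add,
        mul_smul_comm, mul_smul_comm]
    rw [hcast, succ_mul_expV, map_sum, Finset.sum_congr rfl hterm, Finset.sum_add_distrib, hsum,
      ← Finset.smul_sum, sum_mul_shiftV, shiftV_succ_succ, mul_smul_comm, mul_smul_comm,
      ← smul_add]
    congr 1
    push_cast
    ring

lemma mul_neg_mul_neg_inv {K : Type*} [Field K] {a b : K} (ha : a ≠ 0) (hb : b ≠ 0) :
    a * (-b * -(a * b)⁻¹) = 1 := by
  field_simp

lemma succ_mul_expVScalar (i : ℕ) :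
    ((i + 1 : ℕ) : F) * (-(1 - q ^ (i + 1)) * expVScalar (i + 1)) = 1 := by
  have h₁ := one_sub_q_pow_succ_ne_zero i
  have h₂ : ((i + 1 : ℕ) : F) ≠ 0 := Nat.cast_ne_zero.2 i.succ_ne_zero
  exact mul_neg_mul_neg_inv h₂ h₁

lemma succ_mul_Nminus_expV_mul (b c : ℕ) (g : SF) :
    ((b + 1 : ℕ) : SF) * Nminus (b + 1) (expV c * g) =
      ∑ x ∈ Finset.HasAntidiagonal.antidiagonal b, ((x.1 + 1 : ℕ) : SF) *
        Nminus x.2 (expV c * (-(1 - q ^ (x.1 + 1)) • pd (x.1 + 1) g)) +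
      ∑ x ∈ Finset.HasAntidiagonal.antidiagonal b, Nminus x.2 (shiftV c (x.1 + 1) * g) := by
  rw [succ_mul_Nminus, ← Finset.sum_add_distrib]
  refine Finset.sum_congr rfl fun x _ => ?_
  have h : ((x.1 + 1 : ℕ) : SF) * Nminus x.2
      ((-(1 - q ^ (x.1 + 1)) * expVScalar (x.1 + 1)) • (shiftV c (x.1 + 1) * g)) =
      Nminus x.2 (shiftV c (x.1 + 1) * g) := by
    rw [← nsmul_eq_mul, ← Nat.cast_smul_eq_nsmul F, map_smul, smul_smul,
      succ_mul_expVScalar, one_smul]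
  rw [pd_mul, pd_expV, smul_add, map_add, mul_add, ← mul_smul_comm, smul_mul_assoc, smul_smul, h]

/-- Commutation of the degree-lowering vertex operator with multiplication by
`exp (-∑_{m>0} p_m w^m/(m(1-q^m)))`, in the form of a two-term relation. -/
lemma Nminus_succ_expV_succ_mul (b : ℕ) : ∀ (c : ℕ) (g : SF),
    Nminus (b + 1) (expV (c + 1) * g) =
      expV (c + 1) * Nminus (b + 1) g + Nminus b (expV c * g) := by
  induction b using Nat.strong_induction_on with
  | _ b ih =>
  intro c g
  have hb : ((b + 1 : ℕ) : SF) ≠ 0 := Nat.cast_ne_zero.2 b.succ_ne_zero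
  refine mul_left_cancel₀ hb ?_
  have h₁ := succ_mul_Nminus_expV_mul b (c + 1) g
  have h₂ := succ_mul_Nminus b g
  simp only [shiftV_succ_succ] at h₁
  cases b with
  | zero =>
    simp only [Finset.Nat.antidiagonal_zero, Finset.sum_singleton, Nminus_zero,
      shiftV_zero_right] at h₁ h₂ ⊢
    linear_combination h₁ - expV (c + 1) * h₂
  | succ b =>
    have h₃ := succ_mul_Nminus_expV_mul b c g
    have h₄ : ∑ x ∈ Finset.HasAntidiagonal.antidiagonal b, ((x.1 + 1 : ℕ) : SF) *
        Nminus (x.2 + 1) (expV (c + 1) * (-(1 - q ^ (x.1 + 1)) • pd (x.1 + 1) g)) =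
        expV (c + 1) * ∑ x ∈ Finset.HasAntidiagonal.antidiagonal b, ((x.1 + 1 : ℕ) : SF) *
          Nminus (x.2 + 1) (-(1 - q ^ (x.1 + 1)) • pd (x.1 + 1) g) +
        ∑ x ∈ Finset.HasAntidiagonal.antidiagonal b, ((x.1 + 1 : ℕ) : SF) *
          Nminus x.2 (expV c * (-(1 - q ^ (x.1 + 1)) • pd (x.1 + 1) g)) := by
      rw [Finset.mul_sum, ← Finset.sum_add_distrib]
      refine Finset.sum_congr rfl fun x hx => ?_
      have hxb := Finset.HasAntidiagonal.mem_antidiagonal.1 hx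
      rw [ih x.2 (by lia), mul_add, mul_left_comm]
    rw [Finset.Nat.sum_antidiagonal_succ', Finset.Nat.sum_antidiagonal_succ, h₄] at h₁
    rw [Finset.Nat.sum_antidiagonal_succ'] at h₂
    simp only [Nminus_zero, shiftV_zero_right] at h₁ h₂
    push_cast at h₁ h₂ h₃ ⊢
    linear_combination h₁ - expV (c + 1) * h₂ - h₃

lemma eta_expV_succ_mul (a : ℤ) (c : ℕ) (g : SF) :
    eta a (expV (c + 1) * g) = expV (c + 1) * eta a g + eta (a - 1) (expV c * g) := by
  obtain ⟨M, h₁, h₂, h₃⟩ : ∃ M, wdeg (expV (c + 1) * g) + 1 ≤ M + 1 ∧ wdeg g + 1 ≤ M + 1 ∧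
      wdeg (expV c * g) + 1 ≤ M :=
    ⟨wdeg (expV (c + 1) * g) + wdeg g + (wdeg (expV c * g) + 1), by lia, by lia, by lia⟩
  rw [eta_eq_sum _ _ h₁, eta_eq_sum _ _ h₂, eta_eq_sum _ _ h₃, Finset.sum_range_succ',
    Finset.sum_range_succ', mul_add, Finset.mul_sum, add_right_comm, ← Finset.sum_add_distrib]
  congr 1
  · refine Finset.sum_congr rfl fun b _ => ?_
    have hb : ((b + 1 : ℕ) : ℤ) - a = (b : ℤ) - (a - 1) := by push_cast; ring
    by_cases h : a ≤ ((b + 1 : ℕ) : ℤ)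
    · have h' : a - 1 ≤ (b : ℤ) := by lia
      rw [if_pos h, if_pos h, if_pos h', Nminus_succ_expV_succ_mul, map_add, Pplus_mul, hb]
    · have h' : ¬a - 1 ≤ (b : ℤ) := by lia
      rw [if_neg h, if_neg h, if_neg h', mul_zero, zero_add]
  · simp only [Nminus_zero, Pplus_mul, mul_ite, mul_zero]

lemma eta_expV_mul (b : ℕ) : ∀ (a : ℤ) (g : SF),
    eta a (expV b * g) = ∑ k ∈ Finset.range (b + 1), expV (b - k) * eta (a - (k : ℤ)) g := by
  induction b with
  | zero => intro a g; simp [expV_zero]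
  | succ b ih =>
    intro a g
    rw [eta_expV_succ_mul, ih, Finset.sum_range_succ' _ (b + 1), add_comm]
    congr 1
    · refine Finset.sum_congr rfl fun k _ => ?_
      rw [Nat.add_sub_add_right, Nat.cast_succ, sub_sub, add_comm (1 : ℤ)]
    · simp

lemma v0_eq (n : ℕ) : v0 n = (-1) ^ n * expV n := rfl

lemma eta_neg_one_pow_mul (d : ℤ) (n : ℕ) (f : SF) :
    eta d ((-1) ^ n * f) = (-1) ^ n * eta d f := by
  rcases neg_one_pow_eq_or SF n with h | h
  · rw [h, one_mul, one_mul]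
  · rw [h, neg_one_mul, neg_one_mul, eta_neg]

/-- For all integers `a ∈ ℤ`, `b ≥ 0` and every `g ∈ Λ_F`:
`η_a (v⁽⁰⁾_b ⬝ g) = ∑_{k=0}^{b} (-1)^k v⁽⁰⁾_{b-k} ⬝ (η_{a-k} g)`. -/
theorem stmt4 (a : ℤ) (b : ℕ) (g : SF) :
    eta a (v0 b * g) =
      ∑ k ∈ Finset.range (b + 1), (-1 : SF) ^ k * (v0 (b - k) * eta (a - (k : ℤ)) g) := by
  rw [v0_eq, mul_assoc, eta_neg_one_pow_mul, eta_expV_mul, Finset.mul_sum]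
  refine Finset.sum_congr rfl fun k hk => ?_
  have hkb : k + (b - k) = b := Nat.add_sub_cancel' (Finset.mem_range_succ_iff.1 hk)
  rw [v0_eq, mul_assoc, ← mul_assoc ((-1) ^ k), ← pow_add, hkb]
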